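/- There is no nonempty compact simply connected topological 1-manifold without boundary. That is, if M is a nonempty Hausdorff, second countable topological space that is a charted space over 1-dimensional Euclidean space, and M is compact and simply connected, then a contradiction follows. -/

import Mathlib

open Set Topology

section

variable {M : Type*} [TopologicalSpace M]

/-- Around every point of a one-dimensional manifold there is a real-valued chart whose target
contains `[0, 1]`, in which the point has coordinate `1 / 2`, and for which the arc parametrized
by `[0, 1]` lies in a prescribed neighbourhood. -/
theorem exists_openPartialHomeomorph_unitInterval
    [ChartedSpace (EuclideanSpace ℝ (Fin 1)) M] (q : M) {U : Set M} (hU : U ∈ 𝓝 q) :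
    ∃ φ : OpenPartialHomeomorph M ℝ, q ∈ φ.source ∧ φ q = 1 / 2 ∧ Icc 0 1 ⊆ φ.target ∧
      MapsTo φ.symm (Icc 0 1) U := by
  let h : EuclideanSpace ℝ (Fin 1) ≃ₜ ℝ :=
    (EuclideanSpace.equiv (Fin 1) ℝ).toHomeomorph.trans (Homeomorph.funUnique (Fin 1) ℝ)
  let ψ : OpenPartialHomeomorph M ℝ := (chartAt (EuclideanSpace ℝ (Fin 1)) q).transHomeomorph h
  have hq : q ∈ ψ.source := mem_chart_source _ q
  have hnhds : ψ.target ∩ ψ.symm ⁻¹' U ∈ 𝓝 (ψ q) := by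
    refine Filter.inter_mem (ψ.open_target.mem_nhds (ψ.map_source hq)) ?_
    exact (ψ.continuousAt_symm (ψ.map_source hq)).preimage_mem_nhds (by rwa [ψ.left_inv hq])
  obtain ⟨ε, hε, hball⟩ := Metric.mem_nhds_iff.1 hnhds
  let a : ℝ ≃ₜ ℝ := (Homeomorph.addRight (-ψ q)).trans
    ((Homeomorph.mulRight₀ ε⁻¹ (inv_ne_zero hε.ne')).trans (Homeomorph.addRight (1 / 2)))
  have ha (t : ℝ) (ht : t ∈ Icc (0 : ℝ) 1) : a.symm t ∈ Metric.ball (ψ q) ε := by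
    have : a.symm t = ψ q + ε * (t - 1 / 2) := by
      rw [Homeomorph.symm_apply_eq]
      simp only [a, Homeomorph.trans_apply, Homeomorph.coe_addRight, Homeomorph.coe_mulRight₀]
      field_simp
      ring
    rw [this, Metric.mem_ball, Real.dist_eq, abs_lt]
    constructor <;> nlinarith [ht.1, ht.2]
  refine ⟨ψ.transHomeomorph a, hq, ?_, fun t ht ↦ (hball (ha t ht)).1,
    fun t ht ↦ (hball (ha t ht)).2⟩
  simp [a]

/-- A continuous function `M → [0, 1]` that vanishes at `p`, attains `1`, and attains each value
in `(0, 1)` at only one point. -/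
structure IsCutFunction (p : M) (f : M → ℝ) : Prop where
  continuous : Continuous f
  mem_Icc (x : M) : f x ∈ Icc (0 : ℝ) 1
  apply_base : f p = 0
  exists_eq_one : ∃ x, f x = 1
  eq_of_eq ⦃x y : M⦄ : f x ∈ Ioo (0 : ℝ) 1 → f x = f y → x = y

namespace IsCutFunction

variable {p : M} {f g : M → ℝ}

theorem isPreconnected_setOf_le [PreconnectedSpace M] (hf : IsCutFunction p f) {s : ℝ}
    (hs : s ∈ Ioo (0 : ℝ) 1) : IsPreconnected {x | f x ≤ s} := by
  obtain ⟨b, hb⟩ := hf.exists_eq_one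
  obtain ⟨x, hx⟩ : s ∈ range f := mem_range_of_exists_le_of_exists_ge hf.continuous
    ⟨p, hf.apply_base.trans_le hs.1.le⟩ ⟨b, hs.2.le.trans_eq hb.symm⟩
  have hr : Continuous fun z ↦ if f z ≤ s then z else x :=
    continuous_id.if_le continuous_const hf.continuous continuous_const fun z hz ↦
      (hf.eq_of_eq (hx ▸ hs) (hx.trans hz.symm)).symm
  convert isPreconnected_range hr using 1
  ext z
  constructor
  · exact fun hz ↦ ⟨z, if_pos hz⟩
  · rintro ⟨w, rfl⟩
    by_cases hw : f w ≤ s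
    · simp [hw]
    · simp [hw, hx]

theorem le_of_lt [PreconnectedSpace M] (hf : IsCutFunction p f) (hg : IsCutFunction p g)
    {x y : M} (hx : f x ∈ Ioo (0 : ℝ) 1) (hxy : f x < f y) : g x ≤ g y := by
  by_contra! hlt
  have hs : (g y + g x) / 2 ∈ Ioo (0 : ℝ) 1 := by
    constructor <;> linarith [(hg.mem_Icc y).1, (hg.mem_Icc x).2]
  obtain ⟨z, hz, hzx⟩ := (hg.isPreconnected_setOf_le hs).intermediate_value
    (show g p ≤ _ from hg.apply_base.trans_le hs.1.le) (show g y ≤ _ by linarith)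
    hf.continuous.continuousOn ⟨hf.apply_base.trans_le hx.1.le, hxy.le⟩
  obtain rfl := hf.eq_of_eq hx hzx.symm
  have : g x ≤ (g y + g x) / 2 := hz
  linarith

end IsCutFunction

/-- The lift to `ℝ` of the map collapsing the complement of a small arc around `q` to a point
of the circle is, up to an affine change of the values, a cut function. -/
theorem exists_isCutFunction [T2Space M] [ChartedSpace (EuclideanSpace ℝ (Fin 1)) M]
    [SimplyConnectedSpace M] {p q : M} (hpq : q ≠ p) :
    ∃ f, IsCutFunction p f ∧ f q ∈ Ioo (0 : ℝ) 1 := by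
  classical
  have : LocallyPathConnectedSpace M :=
    ChartedSpace.locallyPathConnectedSpace (EuclideanSpace ℝ (Fin 1)) M
  obtain ⟨φ, hqs, hq, htarget, hp⟩ :=
    exists_openPartialHomeomorph_unitInterval q (isOpen_ne.mem_nhds hpq)
  set K : Set M := φ.symm '' Icc 0 1 with hK
  have hKs : K ⊆ φ.source := by
    rintro _ ⟨t, ht, rfl⟩
    exact φ.map_target (htarget ht)
  have hKmem {x : M} (hx : x ∈ K) : φ x ∈ Icc (0 : ℝ) 1 := by
    obtain ⟨t, ht, rfl⟩ := hx
    rwa [φ.right_inv (htarget ht)]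
  have hsymm : ContinuousOn φ.symm (Icc 0 1) := φ.continuousOn_symm.mono htarget
  have hKclosed : IsClosed K := (isCompact_Icc.image_of_continuousOn hsymm).isClosed
  have hKconn : IsPreconnected K := isPreconnected_Icc.image _ hsymm
  have hqK : q ∈ K := ⟨1 / 2, by constructor <;> norm_num, by rw [← hq, φ.left_inv hqs]⟩
  have hpK : p ∉ K := by
    rintro ⟨t, ht, rfl⟩
    exact hp ht rfl
  have hfrontier {x : M} (hx : x ∈ frontier K) : φ x = 0 ∨ φ x = 1 := by
    have hxK : x ∈ K := hKclosed.frontier_subset hx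
    by_contra! hne
    have hIoo : φ x ∈ Ioo (0 : ℝ) 1 :=
      ⟨(hKmem hxK).1.lt_of_ne hne.1.symm, (hKmem hxK).2.lt_of_ne hne.2⟩
    refine hx.2 (mem_interior_iff_mem_nhds.2 ?_)
    filter_upwards [φ.open_source.mem_nhds (hKs hxK),
      (φ.continuousAt (hKs hxK)).preimage_mem_nhds (isOpen_Ioo.mem_nhds hIoo)] with y hy hy'
    exact ⟨φ y, Ioo_subset_Icc_self hy', φ.left_inv hy⟩
  have hc : Continuous (K.piecewise (fun x ↦ (φ x : AddCircle (1 : ℝ))) fun _ ↦ 0) := by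
    refine continuous_piecewise (fun x hx ↦ ?_) ?_ continuousOn_const
    · rcases hfrontier hx with h | h
      · simp [h]
      · simp [h]
    · rw [hKclosed.closure_eq]
      exact (AddCircle.continuous_mk' (1 : ℝ)).comp_continuousOn (φ.continuousOn.mono hKs)
  have hcover := AddCircle.isCoveringMap_coe (1 : ℝ)
  obtain ⟨f, ⟨hfq, hf⟩, -⟩ := hcover.existsUnique_continuousMap_lifts ⟨_, hc⟩ q (φ q)
    (by simp [hqK])
  have hfK : EqOn f φ K := by
    refine hcover.eqOn_of_comp_eqOn hKconn f.continuous.continuousOn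
      (φ.continuousOn.mono hKs) (fun x hx ↦ ?_) hqK hfq
    simpa [hx] using congrFun hf x
  have hfint {x : M} (hx : x ∉ K) : ∃ n : ℤ, f x = n := by
    have : (f x : AddCircle (1 : ℝ)) = 0 := by simpa [hx] using congrFun hf x
    obtain ⟨n, hn⟩ := (AddCircle.coe_eq_zero_iff (1 : ℝ)).1 this
    exact ⟨n, by simpa using hn.symm⟩
  have hgap (m : ℤ) (hm : m ≠ 0) (x : M) : f x ≠ m + 1 / 2 := by
    intro hx
    by_cases hxK : x ∈ K
    · have h := hKmem hxK
      rw [← hfK hxK, hx] at h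
      have h1 : (-1 : ℝ) < m := by linarith [h.1]
      have h2 : (m : ℝ) < 1 := by linarith [h.2]
      norm_cast at h1 h2
      omega
    · obtain ⟨n, hn⟩ := hfint hxK
      have : (2 * n : ℝ) = 2 * m + 1 := by linarith
      norm_cast at this
      omega
  have hmem (x : M) : f x ∈ Icc (0 : ℝ) 1 := by
    by_cases hxK : x ∈ K
    · exact hfK hxK ▸ hKmem hxK
    obtain ⟨n, hn⟩ := hfint hxK
    by_contra hx
    have hn' : n ≤ -1 ∨ 2 ≤ n := by
      by_contra! hn'
      obtain rfl | rfl : n = 0 ∨ n = 1 := by omega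
      all_goals simp [hn] at hx
    rcases hn' with h | h
    · have h' : (n : ℝ) ≤ -1 := by exact_mod_cast h
      obtain ⟨z, hz⟩ := mem_range_of_exists_le_of_exists_ge f.continuous (c := -1 / 2)
        ⟨x, by linarith⟩ ⟨q, by linarith⟩
      exact hgap (-1) (by norm_num) z (by rw [hz]; norm_num)
    · have h' : (2 : ℝ) ≤ n := by exact_mod_cast h
      obtain ⟨z, hz⟩ := mem_range_of_exists_le_of_exists_ge f.continuous (c := 3 / 2)
        ⟨q, by linarith⟩ ⟨x, by linarith⟩
      exact hgap 1 (by norm_num) z (by rw [hz]; norm_num)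
  have hIoo {x : M} (hx : f x ∈ Ioo (0 : ℝ) 1) : x ∈ K := by
    by_contra hxK
    obtain ⟨n, hn⟩ := hfint hxK
    rw [hn] at hx
    have h1 := hx.1
    have h2 := hx.2
    norm_cast at h1 h2
    omega
  have hinj ⦃x y : M⦄ (hx : f x ∈ Ioo (0 : ℝ) 1) (hxy : f x = f y) : x = y := by
    have hxK := hIoo hx
    have hyK := hIoo (hxy ▸ hx)
    rw [hfK hxK, hfK hyK] at hxy
    exact φ.injOn (hKs hxK) (hKs hyK) hxy
  have hval {t : ℝ} (ht : t ∈ Icc (0 : ℝ) 1) : f (φ.symm t) = t := by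
    rw [hfK ⟨t, ht, rfl⟩, φ.right_inv (htarget ht)]
  have hfq' : f q ∈ Ioo (0 : ℝ) 1 := by
    rw [hfq, hq]
    constructor <;> norm_num
  have hfp : f p = 0 ∨ f p = 1 := by
    by_contra! hne
    exact hpK (hIoo ⟨(hmem p).1.lt_of_ne hne.1.symm, (hmem p).2.lt_of_ne hne.2⟩)
  rcases hfp with h | h
  · exact ⟨f, ⟨f.continuous, hmem, h, ⟨_, hval (by simp)⟩, hinj⟩, hfq'⟩
  · refine ⟨fun x ↦ 1 - f x, ⟨by fun_prop, fun x ↦ ?_, by simp [h],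
      ⟨φ.symm 0, by rw [hval (by simp), sub_zero]⟩, fun x y hx hxy ↦ hinj ?_ (by linarith)⟩, ?_⟩
    · exact ⟨by linarith [(hmem x).2], by linarith [(hmem x).1]⟩
    · exact ⟨by linarith [hx.2], by linarith [hx.1]⟩
    · exact ⟨by linarith [hfq'.2], by linarith [hfq'.1]⟩

end

/-- There is no nonempty compact simply connected topological 1-manifold
(without boundary). -/
theorem no_compact_simply_connected_one_manifold
    {M : Type*} [TopologicalSpace M] [T2Space M] [SecondCountableTopology M]
    [ChartedSpace (EuclideanSpace ℝ (Fin 1)) M]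
    [CompactSpace M] [SimplyConnectedSpace M] [Nonempty M] :
    False := by
  obtain ⟨p⟩ := ‹Nonempty M›
  obtain ⟨q, hqp⟩ : ∃ q : M, q ≠ p := by
    obtain ⟨φ, -, hp, htarget, -⟩ := exists_openPartialHomeomorph_unitInterval p Filter.univ_mem
    refine ⟨φ.symm 0, fun h ↦ ?_⟩
    rw [← h, φ.right_inv (htarget (by simp))] at hp
    norm_num at hp
  obtain ⟨f₀, hf₀, -⟩ := exists_isCutFunction hqp
  have hB : IsCompact {x | f₀ x = 1} := (isClosed_eq hf₀.continuous continuous_const).isCompact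
  have hcut (x : {x | f₀ x = 1}) : ∃ f, IsCutFunction p f ∧ f x ∈ Ioo (0 : ℝ) 1 := by
    refine exists_isCutFunction fun h ↦ ?_
    have hx : f₀ x = 1 := x.2
    rw [h, hf₀.apply_base] at hx
    exact zero_ne_one hx
  choose F hF hFx using hcut
  obtain ⟨T, hT⟩ := hB.elim_finite_subcover (fun i ↦ F i ⁻¹' Ioo 0 1)
    (fun i ↦ isOpen_Ioo.preimage (hF i).continuous) fun x hx ↦ mem_iUnion.2 ⟨⟨x, hx⟩, hFx _⟩
  have hcont : Continuous fun x ↦ ∑ i ∈ T, F i x :=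
    continuous_finsetSum _ fun i _ ↦ (hF i).continuous
  obtain ⟨x, hx, hmax⟩ := hB.exists_isMaxOn hf₀.exists_eq_one hcont.continuousOn
  obtain ⟨i, hiT, hi⟩ := mem_iUnion₂.1 (hT hx)
  obtain ⟨y, hy⟩ := (hF i).exists_eq_one
  have hxy : F i x < F i y := hi.2.trans_eq hy.symm
  have hyB : f₀ y = 1 :=
    le_antisymm (hf₀.mem_Icc y).2 (hx.symm.trans_le ((hF i).le_of_lt hf₀ hi hxy))
  have hlt : ∑ j ∈ T, F j x < ∑ j ∈ T, F j y :=
    Finset.sum_lt_sum (fun j _ ↦ (hF i).le_of_lt (hF j) hi hxy) ⟨i, hiT, hxy⟩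
  exact hlt.not_ge (hmax hyB)
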